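/- arXiv:1803.01552 — 2 statements merged into one kernel-verified Lean document; each statement's English description precedes it below -/
import Mathlib

section
/- Let H be a Heyting algebra and let φ : H → H be a disjunctive function whose head set Head(φ) has cardinality n. Then φ^{n+1}(⊥), the (n+1)-fold iterate of φ applied to ⊥, is the least prefixed point of φ. -/
/-- Disjunctive functions on a Heyting algebra, together with their head set
and side set. -/
inductive Disjunctive {H : Type*} [HeytingAlgebra H] [DecidableEq H] :
    (H → H) → Finset H → Finset H → Prop
  | id : Disjunctive (fun x => x) ∅ ∅
  | himp (a : H) {φ : H → H} {Hd Sd : Finset H} :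
      Disjunctive φ Hd Sd → Disjunctive (fun x => a ⇨ φ x) (insert a Hd) Sd
  | side (b : H) {φ : H → H} {Hd Sd : Finset H} :
      Disjunctive φ Hd Sd → Disjunctive (fun x => b ⊔ φ x) Hd (insert b Sd)
  | sup {φ₁ φ₂ : H → H} {Hd₁ Sd₁ Hd₂ Sd₂ : Finset H} :
      Disjunctive φ₁ Hd₁ Sd₁ → Disjunctive φ₂ Hd₂ Sd₂ →
      Disjunctive (fun x => φ₁ x ⊔ φ₂ x) (Hd₁ ∪ Hd₂) (Sd₁ ∪ Sd₂)

namespace Disjunctive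

variable {H : Type*} [HeytingAlgebra H] [DecidableEq H] {φ : H → H} {Hd Sd : Finset H}

theorem monotone (hφ : Disjunctive φ Hd Sd) : Monotone φ := by
  induction hφ with
  | id => exact monotone_id
  | himp a _ ih => exact fun _ _ h => himp_le_himp_left (ih h)
  | side b _ ih => exact fun _ _ h => sup_le_sup_left (ih h) b
  | sup _ _ ih₁ ih₂ => exact ih₁.sup ih₂

theorem le_apply (hφ : Disjunctive φ Hd Sd) (x : H) : x ≤ φ x := by
  induction hφ with
  | id => exact le_rfl
  | himp a _ ih => exact ih.trans le_himp
  | side b _ ih => exact ih.trans le_sup_right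
  | sup _ _ ih₁ _ => exact ih₁.trans le_sup_left

theorem himp_le_apply (hφ : Disjunctive φ Hd Sd) {a : H} (ha : a ∈ Hd) (x : H) :
    a ⇨ x ≤ φ x := by
  induction hφ with
  | id => simp at ha
  | himp c hψ ih =>
    rcases Finset.mem_insert.1 ha with rfl | ha
    · exact himp_le_himp_left (hψ.le_apply x)
    · exact (ih ha).trans le_himp
  | side b _ ih => exact (ih ha).trans le_sup_right
  | sup _ _ ih₁ ih₂ =>
    rcases Finset.mem_union.1 ha with ha | ha
    · exact (ih₁ ha).trans le_sup_left
    · exact (ih₂ ha).trans le_sup_right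

theorem side_le_apply (hφ : Disjunctive φ Hd Sd) {b : H} (hb : b ∈ Sd) (x : H) :
    b ≤ φ x := by
  induction hφ with
  | id => simp at hb
  | himp c _ ih => exact (ih hb).trans le_himp
  | side c _ ih =>
    rcases Finset.mem_insert.1 hb with rfl | hb
    · exact le_sup_left
    · exact (ih hb).trans le_sup_right
  | sup _ _ ih₁ ih₂ =>
    rcases Finset.mem_union.1 hb with hb | hb
    · exact (ih₁ hb).trans le_sup_left
    · exact (ih₂ hb).trans le_sup_right

theorem apply_le (hφ : Disjunctive φ Hd Sd) {x : H} (hHd : ∀ a ∈ Hd, a ⇨ x ≤ x)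
    (hSd : ∀ b ∈ Sd, b ≤ x) : φ x ≤ x := by
  induction hφ with
  | id => exact le_rfl
  | himp a _ ih =>
    exact (himp_le_himp_left (ih (fun c hc => hHd c (Finset.mem_insert_of_mem hc)) hSd)).trans
      (hHd a (Finset.mem_insert_self _ _))
  | side b _ ih =>
    exact sup_le (hSd b (Finset.mem_insert_self _ _))
      (ih hHd fun c hc => hSd c (Finset.mem_insert_of_mem hc))
  | sup _ _ ih₁ ih₂ =>
    exact sup_le
      (ih₁ (fun c hc => hHd c (Finset.mem_union_left _ hc))
        fun c hc => hSd c (Finset.mem_union_left _ hc))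
      (ih₂ (fun c hc => hHd c (Finset.mem_union_right _ hc))
        fun c hc => hSd c (Finset.mem_union_right _ hc))

/-- The element `⋀ Hd ⇨ ⋁ Sd` is a prefixed point of `φ`. -/
theorem apply_inf_himp_sup_le (hφ : Disjunctive φ Hd Sd) :
    φ (Hd.inf _root_.id ⇨ Sd.sup _root_.id) ≤ Hd.inf _root_.id ⇨ Sd.sup _root_.id := by
  refine hφ.apply_le (fun a ha => ?_) fun b hb => ?_
  · have h : Hd.inf _root_.id ≤ a := Finset.inf_le (f := _root_.id) ha
    rw [himp_himp, inf_eq_right.2 h]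
  · exact (Finset.le_sup (f := _root_.id) hb).trans le_himp

theorem inf_himp_sup_le_iterate (hφ : Disjunctive φ Hd Sd) {T : Finset H} (hT : T ⊆ Hd) :
    T.inf _root_.id ⇨ Sd.sup _root_.id ≤ φ^[T.card + 1] ⊥ := by
  induction T using Finset.induction_on with
  | empty => simpa using fun b hb => hφ.side_le_apply hb ⊥
  | insert a T ha ih =>
    rw [Finset.card_insert_of_notMem ha, Function.iterate_succ_apply', Finset.inf_insert,
      _root_.id, ← himp_himp]
    exact (himp_le_himp_left (ih ((Finset.subset_insert a T).trans hT))).trans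
      (hφ.himp_le_apply (hT (Finset.mem_insert_self a T)) _)

theorem iterate_bot_le (hφ : Disjunctive φ Hd Sd) {x : H} (hx : φ x ≤ x) (k : ℕ) :
    φ^[k] ⊥ ≤ x := by
  induction k with
  | zero => exact bot_le
  | succ k ih =>
    rw [Function.iterate_succ_apply']
    exact (hφ.monotone ih).trans hx

end Disjunctive

/-- A disjunctive function `φ` with `n` head subformulas converges to its least
prefixed point in `n + 1` steps. -/
theorem disjunctive_closure_ordinal {H : Type*} [HeytingAlgebra H] [DecidableEq H]
    (φ : H → H) (Hd Sd : Finset H) (hφ : Disjunctive φ Hd Sd)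
    (n : ℕ) (hn : Hd.card = n) :
    IsLeast {x : H | φ x ≤ x} (φ^[n + 1] ⊥) := by
  subst hn
  refine ⟨?_, fun x hx => hφ.iterate_bot_le hx _⟩
  rw [le_antisymm (hφ.iterate_bot_le hφ.apply_inf_himp_sup_le _)
    (hφ.inf_himp_sup_le_iterate subset_rfl)]
  exact hφ.apply_inf_himp_sup_le
end

section
/- Let H be a Heyting algebra and let f, g : H → H be strong monotone functions such that f^m(⊥) is the least prefixed point of f and g^n(⊥) is the least prefixed point of g, with m + n ≥ 1. Then (f ⊓ g)^{m+n−1}(⊥) is the least prefixed point of the pointwise meet f ⊓ g : x ↦ f(x) ⊓ g(x). In particular cl(f ⊓ g) ≤ cl(f) + cl(g) − 1. -/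
theorem iterate_bot_le_of_map_le {α : Type*} [PartialOrder α] [OrderBot α] {h : α → α}
    (hh : Monotone h) {x : α} (hx : h x ≤ x) (k : ℕ) : h^[k] ⊥ ≤ x := by
  induction k with
  | zero => exact bot_le
  | succ k ih =>
    rw [Function.iterate_succ_apply']
    exact (hh ih).trans hx

/-- The meet of the `i`-th and `j`-th approximants of strong monotone functions `f` and `g`
lies below the `(i + j - 1)`-th approximant of `f ⊓ g`. -/
theorem iterate_bot_inf_iterate_bot_le {α : Type*} [SemilatticeInf α] [OrderBot α]
    {f g : α → α} (hf : Monotone f) (hg : Monotone g)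
    (hf' : ∀ x y : α, x ⊓ f y ≤ f (x ⊓ y)) (hg' : ∀ x y : α, x ⊓ g y ≤ g (x ⊓ y))
    (i j : ℕ) : f^[i] ⊥ ⊓ g^[j] ⊥ ≤ (fun x => f x ⊓ g x)^[i + j - 1] ⊥ := by
  induction i generalizing j with
  | zero => simp
  | succ i ihi =>
    induction j with
    | zero => simp
    | succ j ihj =>
      have hi := ihi (j + 1)
      rw [show i + (j + 1) - 1 = i + j by omega] at hi
      rw [show i + 1 + j - 1 = i + j by omega] at ihj
      rw [show i + 1 + (j + 1) - 1 = i + j + 1 by omega,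
        Function.iterate_succ_apply' (fun x => f x ⊓ g x)]
      refine le_inf ?_ ?_
      · rw [Function.iterate_succ_apply' f, inf_comm]
        exact (hf' _ _).trans (hf (inf_comm (f^[i] ⊥) _ ▸ hi))
      · rw [Function.iterate_succ_apply' g]
        exact (hg' _ _).trans (hg ihj)

/-- If strong monotone `f` converges in `m` steps and strong monotone `g`
converges in `n` steps (with `m + n ≥ 1`), then the pointwise meet `f ⊓ g`
converges in `m + n - 1` steps. -/
theorem inf_convergence {H : Type*} [HeytingAlgebra H]
    (f g : H → H) (hf : Monotone f) (hg : Monotone g)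
    (hf' : ∀ x y : H, x ⊓ f y ≤ f (x ⊓ y))
    (hg' : ∀ x y : H, x ⊓ g y ≤ g (x ⊓ y))
    (m n : ℕ) (hmn : 1 ≤ m + n)
    (hfm : IsLeast {x : H | f x ≤ x} (f^[m] ⊥))
    (hgn : IsLeast {x : H | g x ≤ x} (g^[n] ⊥)) :
    IsLeast {x : H | f x ⊓ g x ≤ x} ((fun x => f x ⊓ g x)^[m + n - 1] ⊥) := by
  have hh : Monotone fun x => f x ⊓ g x := hf.inf hg
  refine ⟨?_, fun x hx => iterate_bot_le_of_map_le hh hx _⟩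
  refine (Function.iterate_succ_apply' (fun x => f x ⊓ g x) _ ⊥).symm.trans_le ?_
  exact (le_inf (iterate_bot_le_of_map_le hh (inf_le_left.trans hfm.1) _)
    (iterate_bot_le_of_map_le hh (inf_le_right.trans hgn.1) _)).trans
    (iterate_bot_inf_iterate_bot_le hf hg hf' hg' m n)
end
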